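/- Let n ≥ 1, Ω ⊆ ℝⁿ open, m_S > 0, and α₁, α₂ ∈ ℝ with m_S²α₁² + α₂² ≠ 0; set α̂₁ := α₁/(m_S²α₁² + α₂²), α̂₂ := α₂/(m_S²α₁² + α₂²). Let h : ℝ × Ω → ℝ³ and let m : ℝ × Ω → ℝ³ be differentiable in time and twice continuously differentiable in space with ‖m(t,x)‖ = m_S for all (t,x). If m satisfies m_t = −α₁ m × (m × (Δm + h)) + α₂ m × (Δm + h) pointwise on ℝ × Ω, then m satisfies α̂₁ m_S² m_t − α̂₂ m × m_t − m_S² Δm = |∇m|² m + m_S² h − ⟨m, h⟩ m pointwise on ℝ × Ω. -/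

import Mathlib

/-- The cross product on three-dimensional Euclidean space `ℝ³ = EuclideanSpace ℝ (Fin 3)`. -/
noncomputable def cross3 (a b : EuclideanSpace ℝ (Fin 3)) : EuclideanSpace ℝ (Fin 3) :=
  !₂[a 1 * b 2 - a 2 * b 1, a 2 * b 0 - a 0 * b 2, a 0 * b 1 - a 1 * b 0]

/-- The `j`-th partial derivative of a vector field `u : ℝⁿ → ℝ³`. -/
noncomputable def pderiv3 {n : ℕ} (u : EuclideanSpace ℝ (Fin n) → EuclideanSpace ℝ (Fin 3))
    (j : Fin n) (x : EuclideanSpace ℝ (Fin n)) : EuclideanSpace ℝ (Fin 3) :=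
  fderiv ℝ u x (EuclideanSpace.single j 1)

/-- The componentwise Laplacian `Δu = Σ_j ∂²u/∂x_j²` of a vector field `u : ℝⁿ → ℝ³`. -/
noncomputable def laplacian3 {n : ℕ} (u : EuclideanSpace ℝ (Fin n) → EuclideanSpace ℝ (Fin 3))
    (x : EuclideanSpace ℝ (Fin n)) : EuclideanSpace ℝ (Fin 3) :=
  ∑ j : Fin n, pderiv3 (fun y => pderiv3 u j y) j x

theorem cross3_add_right (a b c : EuclideanSpace ℝ (Fin 3)) :
    cross3 a (b + c) = cross3 a b + cross3 a c := by
  ext i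
  fin_cases i <;> simp [cross3] <;> ring

theorem cross3_smul_right (r : ℝ) (a b : EuclideanSpace ℝ (Fin 3)) :
    cross3 a (r • b) = r • cross3 a b := by
  ext i
  fin_cases i <;> simp [cross3] <;> ring

theorem cross3_cross3_self (a v : EuclideanSpace ℝ (Fin 3)) :
    cross3 a (cross3 a v) = (inner ℝ a v : ℝ) • a - (‖a‖ ^ 2) • v := by
  rw [EuclideanSpace.real_norm_sq_eq]
  ext i
  fin_cases i <;> simp [cross3, PiLp.inner_apply, Fin.sum_univ_three] <;> ring

theorem inner_self_cross3 (a v : EuclideanSpace ℝ (Fin 3)) :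
    (inner ℝ a (cross3 a v) : ℝ) = 0 := by
  simp [cross3, PiLp.inner_apply, Fin.sum_univ_three]
  ring

/-- A differentiable field of constant modulus is orthogonal to its partial derivatives. -/
theorem inner_pderiv3_eq_zero {n : ℕ} {Ω : Set (EuclideanSpace ℝ (Fin n))} (hΩ : IsOpen Ω)
    {u : EuclideanSpace ℝ (Fin n) → EuclideanSpace ℝ (Fin 3)} {c : ℝ}
    (hu : DifferentiableOn ℝ u Ω) (hc : ∀ x ∈ Ω, ‖u x‖ = c) (j : Fin n)
    {x : EuclideanSpace ℝ (Fin n)} (hx : x ∈ Ω) : (inner ℝ (u x) (pderiv3 u j x) : ℝ) = 0 := by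
  have hd : DifferentiableAt ℝ u x := hu.differentiableAt (hΩ.mem_nhds hx)
  have hconst : (fun y => (inner ℝ (u y) (u y) : ℝ)) =ᶠ[nhds x] fun _ => c ^ 2 := by
    filter_upwards [hΩ.mem_nhds hx] with y hy
    rw [real_inner_self_eq_norm_sq, hc y hy]
  have h0 := fderiv_inner_apply ℝ hd hd (EuclideanSpace.single j 1)
  rw [hconst.fderiv_eq, real_inner_comm (u x)] at h0
  simp only [fderiv_fun_const, Pi.zero_apply, zero_apply] at h0
  unfold pderiv3
  linarith

/-- For a field `u` of constant modulus, `⟨u, Δu⟩ = -|∇u|²`. -/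
theorem inner_laplacian3_eq_neg {n : ℕ} {Ω : Set (EuclideanSpace ℝ (Fin n))} (hΩ : IsOpen Ω)
    {u : EuclideanSpace ℝ (Fin n) → EuclideanSpace ℝ (Fin 3)} {c : ℝ}
    (hu : ContDiffOn ℝ 2 u Ω) (hc : ∀ x ∈ Ω, ‖u x‖ = c)
    {x : EuclideanSpace ℝ (Fin n)} (hx : x ∈ Ω) :
    (inner ℝ (u x) (laplacian3 u x) : ℝ) = -∑ j : Fin n, ‖pderiv3 u j x‖ ^ 2 := by
  have hdiff : DifferentiableOn ℝ u Ω := hu.differentiableOn (by norm_num)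
  have hd : DifferentiableAt ℝ u x := hdiff.differentiableAt (hΩ.mem_nhds hx)
  have hfd : DifferentiableAt ℝ (fderiv ℝ u) x :=
    ((hu.contDiffAt (hΩ.mem_nhds hx)).fderiv_right (m := 1) (by norm_num)).differentiableAt
      (by norm_num)
  rw [laplacian3, inner_sum, ← Finset.sum_neg_distrib]
  refine Finset.sum_congr rfl fun j _ => ?_
  have hpd : DifferentiableAt ℝ (fun y => pderiv3 u j y) x :=
    hfd.clm_apply (differentiableAt_const _)
  have hzero : (fun y => (inner ℝ (u y) (pderiv3 u j y) : ℝ)) =ᶠ[nhds x] fun _ => 0 := by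
    filter_upwards [hΩ.mem_nhds hx] with y hy
    exact inner_pderiv3_eq_zero hΩ hdiff hc j hy
  have h0 := fderiv_inner_apply ℝ hd hpd (EuclideanSpace.single j 1)
  rw [hzero.fderiv_eq] at h0
  simp only [fderiv_fun_const, Pi.zero_apply, zero_apply] at h0
  change 0 = inner ℝ (u x) (pderiv3 (fun y => pderiv3 u j y) j x) +
    inner ℝ (pderiv3 u j x) (pderiv3 u j x) at h0
  rw [real_inner_self_eq_norm_sq] at h0
  linarith

/-- If a magnetization `m` of constant modulus `m_S` satisfies the Landau-Lifshitz-Gilbert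
equation `m_t = −α₁ m × (m × (Δm + h)) + α₂ m × (Δm + h)` on `ℝ × Ω`, then it satisfies the
reformulation `αhat₁ m_S² m_t − αhat₂ m × m_t − m_S² Δm = |∇m|² m + m_S² h − ⟨m, h⟩ m`,
where `αhat₁ := α₁/(m_S²α₁² + α₂²)` and `αhat₂ := α₂/(m_S²α₁² + α₂²)`. -/
theorem llg_implies_reformulated (n : ℕ) (hn : 1 ≤ n)
    (Ω : Set (EuclideanSpace ℝ (Fin n))) (hΩ : IsOpen Ω)
    (mS α₁ α₂ : ℝ) (hmS : 0 < mS) (hden : mS ^ 2 * α₁ ^ 2 + α₂ ^ 2 ≠ 0)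
    (αhat₁ αhat₂ : ℝ) (hαhat₁ : αhat₁ = α₁ / (mS ^ 2 * α₁ ^ 2 + α₂ ^ 2))
    (hαhat₂ : αhat₂ = α₂ / (mS ^ 2 * α₁ ^ 2 + α₂ ^ 2))
    (h : ℝ → EuclideanSpace ℝ (Fin n) → EuclideanSpace ℝ (Fin 3))
    (m : ℝ → EuclideanSpace ℝ (Fin n) → EuclideanSpace ℝ (Fin 3))
    (hmt : ∀ x ∈ Ω, ∀ t : ℝ, DifferentiableAt ℝ (fun s => m s x) t)
    (hmx : ∀ t : ℝ, ContDiffOn ℝ 2 (m t) Ω)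
    (hmod : ∀ t : ℝ, ∀ x ∈ Ω, ‖m t x‖ = mS)
    (hllg : ∀ t : ℝ, ∀ x ∈ Ω,
      deriv (fun s => m s x) t
        = -α₁ • cross3 (m t x) (cross3 (m t x) (laplacian3 (m t) x + h t x))
          + α₂ • cross3 (m t x) (laplacian3 (m t) x + h t x)) :
    ∀ t : ℝ, ∀ x ∈ Ω,
      (αhat₁ * mS ^ 2) • deriv (fun s => m s x) t
          - αhat₂ • cross3 (m t x) (deriv (fun s => m s x) t)
          - (mS ^ 2) • laplacian3 (m t) x
        = (∑ j : Fin n, ‖pderiv3 (m t) j x‖ ^ 2) • m t x + (mS ^ 2) • h t x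
          - (inner ℝ (m t x) (h t x) : ℝ) • m t x := by
  intro t x hx
  have hlap := inner_laplacian3_eq_neg hΩ (hmx t) (hmod t) hx
  have hdouble := cross3_cross3_self (m t x) (laplacian3 (m t) x + h t x)
  have htriple := cross3_cross3_self (m t x) (cross3 (m t x) (laplacian3 (m t) x + h t x))
  rw [inner_self_cross3, hmod t x hx, zero_smul, zero_sub] at htriple
  rw [inner_add_right, hlap, hmod t x hx] at hdouble
  have hsum : αhat₁ * mS ^ 2 * α₁ + αhat₂ * α₂ = 1 := by
    rw [hαhat₁, hαhat₂, ← div_self hden]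
    ring
  have hswap : αhat₁ * α₂ = αhat₂ * α₁ := by
    rw [hαhat₁, hαhat₂]
    ring
  have hmain : (αhat₁ * mS ^ 2) • deriv (fun s => m s x) t
      - αhat₂ • cross3 (m t x) (deriv (fun s => m s x) t)
      = -cross3 (m t x) (cross3 (m t x) (laplacian3 (m t) x + h t x)) := by
    rw [hllg t x hx, cross3_add_right _ (-α₁ • _), cross3_smul_right, cross3_smul_right, htriple]
    match_scalars
    · linear_combination -hsum
    · linear_combination mS ^ 2 * hswap
  rw [hmain, hdouble]
  module
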